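/- arXiv:2512.21541 — 4 statements merged into one kernel-verified Lean document; each statement's English description precedes it below -/
import Mathlib

section
/- Let (Ω, 𝓕, P) be a probability space, A, Θ : Ω → ℝ random variables and B ∈ 𝓕 an event such that P({A ≤ s} ∩ B) = P(A ≤ s)·P(B) for every s ∈ ℝ. Then for every x ∈ ℝ and ε > 0, P({A+Θ ≤ x} ∩ B) ≤ P(A+Θ ≤ x+2ε)·P(B) + 2·P(|Θ| > ε). -/
open MeasureTheory

/-- Upper sandwich bound: if `A` is independent of the event `B` (in the sense that
`P({A ≤ s} ∩ B) = P(A ≤ s) P(B)` for all `s`), then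
`P({A+Θ ≤ x} ∩ B) ≤ P(A+Θ ≤ x+2ε) P(B) + 2 P(|Θ| > ε)`. -/
theorem stmt_6 {Ω : Type*} [MeasurableSpace Ω] (P : Measure Ω) [IsProbabilityMeasure P]
    (A Θ : Ω → ℝ) (hA : Measurable A) (hΘ : Measurable Θ)
    (B : Set Ω) (hB : MeasurableSet B)
    (hindep : ∀ s : ℝ, (P ({ω | A ω ≤ s} ∩ B)).toReal
      = (P {ω | A ω ≤ s}).toReal * (P B).toReal) :
    ∀ (x ε : ℝ), 0 < ε →
      (P ({ω | A ω + Θ ω ≤ x} ∩ B)).toReal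
        ≤ (P {ω | A ω + Θ ω ≤ x + 2 * ε}).toReal * (P B).toReal
          + 2 * (P {ω | ε < |Θ ω|}).toReal := by
  intro x ε hε
  change P.real _ ≤ P.real _ * P.real _ + 2 * P.real _
  have hi : P.real ({ω | A ω ≤ x + ε} ∩ B) = P.real {ω | A ω ≤ x + ε} * P.real B :=
    hindep (x + ε)
  have h1 : P.real ({ω | A ω + Θ ω ≤ x} ∩ B)
      ≤ P.real ({ω | A ω ≤ x + ε} ∩ B) + P.real {ω | ε < |Θ ω|} := by
    refine (measureReal_mono ?_).trans (measureReal_union_le _ _)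
    rintro ω ⟨h, hb⟩
    by_cases ht : ε < |Θ ω|
    · exact Or.inr ht
    · refine Or.inl ⟨?_, hb⟩
      have h' := abs_le.mp (not_lt.mp ht)
      simp only [Set.mem_setOf_eq] at h ⊢
      linarith [h'.1]
  have h2 : P.real {ω | A ω ≤ x + ε}
      ≤ P.real {ω | A ω + Θ ω ≤ x + 2 * ε} + P.real {ω | ε < |Θ ω|} := by
    refine (measureReal_mono ?_).trans (measureReal_union_le _ _)
    intro ω h
    by_cases ht : ε < |Θ ω|
    · exact Or.inr ht
    · refine Or.inl ?_
      have h' := abs_le.mp (not_lt.mp ht)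
      simp only [Set.mem_setOf_eq] at h ⊢
      linarith [h'.2]
  have h3 : P.real B ≤ 1 := measureReal_le_one
  have h4 : 0 ≤ P.real B := measureReal_nonneg
  have h5 : 0 ≤ P.real {ω | ε < |Θ ω|} := measureReal_nonneg
  have h6 := mul_le_mul_of_nonneg_right h2 h4
  have h7 := mul_le_mul_of_nonneg_left h3 h5
  linarith
end

section
/- Let (Ω, 𝓕, P) be a probability space, A, Θ : Ω → ℝ random variables and B ∈ 𝓕 an event such that P({A ≤ s} ∩ B) = P(A ≤ s)·P(B) for every s ∈ ℝ. Then for every x ∈ ℝ and ε > 0, P({A+Θ ≤ x} ∩ B) ≥ P(A+Θ ≤ x−2ε)·P(B) − 2·P(|Θ| > ε). -/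
open MeasureTheory

/-- Lower sandwich bound: if `A` is independent of the event `B` (in the sense that
`P({A ≤ s} ∩ B) = P(A ≤ s) P(B)` for all `s`), then
`P({A+Θ ≤ x} ∩ B) ≥ P(A+Θ ≤ x−2ε) P(B) − 2 P(|Θ| > ε)`. -/
theorem stmt_7 {Ω : Type*} [MeasurableSpace Ω] (P : Measure Ω) [IsProbabilityMeasure P]
    (A Θ : Ω → ℝ) (hA : Measurable A) (hΘ : Measurable Θ)
    (B : Set Ω) (hB : MeasurableSet B)
    (hindep : ∀ s : ℝ, (P ({ω | A ω ≤ s} ∩ B)).toReal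
      = (P {ω | A ω ≤ s}).toReal * (P B).toReal) :
    ∀ (x ε : ℝ), 0 < ε →
      (P ({ω | A ω + Θ ω ≤ x} ∩ B)).toReal
        ≥ (P {ω | A ω + Θ ω ≤ x - 2 * ε}).toReal * (P B).toReal
          - 2 * (P {ω | ε < |Θ ω|}).toReal := by
  intro x ε hε
  have key : ∀ S T U : Set Ω, S ⊆ T ∪ U →
      (P S).toReal ≤ (P T).toReal + (P U).toReal := by
    intro S T U h
    exact (measureReal_mono (μ := P) h).trans (measureReal_union_le T U)
  have h1 := key ({ω | A ω ≤ x - ε} ∩ B) ({ω | A ω + Θ ω ≤ x} ∩ B) {ω | ε < |Θ ω|} (by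
    rintro ω ⟨h, hb⟩
    have h' : A ω ≤ x - ε := h
    by_cases hc : ε < |Θ ω|
    · exact Or.inr hc
    · refine Or.inl ⟨?_, hb⟩
      have := le_abs_self (Θ ω)
      show A ω + Θ ω ≤ x
      linarith)
  have h2 := key {ω | A ω + Θ ω ≤ x - 2 * ε} {ω | A ω ≤ x - ε} {ω | ε < |Θ ω|} (by
    intro ω h
    have h' : A ω + Θ ω ≤ x - 2 * ε := h
    by_cases hc : ε < |Θ ω|
    · exact Or.inr hc
    · refine Or.inl ?_
      have := neg_abs_le (Θ ω)
      show A ω ≤ x - ε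
      linarith)
  rw [hindep] at h1
  have hb0 : 0 ≤ (P B).toReal := ENNReal.toReal_nonneg
  have hb1 : (P B).toReal ≤ 1 := measureReal_le_one (μ := P)
  have hu : 0 ≤ (P {ω | ε < |Θ ω|}).toReal := ENNReal.toReal_nonneg
  have h3 := mul_le_mul_of_nonneg_right h2 hb0
  have h4 := mul_le_mul_of_nonneg_left hb1 hu
  linarith
end

section
/- Let (Ω, 𝓕, P) be a probability space, A, Θ : Ω → ℝ random variables and B ∈ 𝓕 an event such that P({A ≤ s} ∩ B) = P(A ≤ s)·P(B) for every s ∈ ℝ. Write F(s) := P(A+Θ ≤ s) and Δ(x) := P({A+Θ ≤ x} ∩ B) − F(x)·P(B). Then for every x ∈ ℝ and ε > 0, |Δ(x)| ≤ P(B)·max{ F(x+2ε) − F(x), F(x) − F(x−2ε) } + 2·P(|Θ| > ε). -/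
open MeasureTheory

/-- Combined deviation bound (equation (A.15) of Lemma A.3): with
`F(s) := P(A+Θ ≤ s)` and `Δ(x) := P({A+Θ ≤ x} ∩ B) − F(x) P(B)`, one has
`|Δ(x)| ≤ P(B) · max{F(x+2ε) − F(x), F(x) − F(x−2ε)} + 2 P(|Θ| > ε)`. -/
theorem stmt_8 {Ω : Type*} [MeasurableSpace Ω] (P : Measure Ω) [IsProbabilityMeasure P]
    (A Θ : Ω → ℝ) (hA : Measurable A) (hΘ : Measurable Θ)
    (B : Set Ω) (hB : MeasurableSet B)
    (hindep : ∀ s : ℝ, (P ({ω | A ω ≤ s} ∩ B)).toReal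
      = (P {ω | A ω ≤ s}).toReal * (P B).toReal)
    (F : ℝ → ℝ) (hF : ∀ s : ℝ, F s = (P {ω | A ω + Θ ω ≤ s}).toReal)
    (Δ : ℝ → ℝ)
    (hΔ : ∀ x : ℝ, Δ x = (P ({ω | A ω + Θ ω ≤ x} ∩ B)).toReal - F x * (P B).toReal) :
    ∀ (x ε : ℝ), 0 < ε →
      |Δ x| ≤ (P B).toReal * max (F (x + 2 * ε) - F x) (F x - F (x - 2 * ε))
        + 2 * (P {ω | ε < |Θ ω|}).toReal := by
  intro x ε hε
  have key : ∀ S T : Set Ω, S ⊆ T ∪ {ω | ε < |Θ ω|} →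
      (P S).toReal ≤ (P T).toReal + (P {ω | ε < |Θ ω|}).toReal := by
    intro S T h
    exact (measureReal_mono h).trans (measureReal_union_le _ _)
  have h1 := key ({ω | A ω + Θ ω ≤ x} ∩ B) ({ω | A ω ≤ x + ε} ∩ B) (by
    rintro ω ⟨h, hb⟩
    by_cases ht : ε < |Θ ω|
    · exact Or.inr ht
    · refine Or.inl ⟨?_, hb⟩
      have := abs_le.1 (not_lt.1 ht)
      simp only [Set.mem_setOf_eq] at h ⊢
      linarith)
  have h2 := key {ω | A ω ≤ x + ε} {ω | A ω + Θ ω ≤ x + 2 * ε} (by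
    intro ω h
    by_cases ht : ε < |Θ ω|
    · exact Or.inr ht
    · refine Or.inl ?_
      have := abs_le.1 (not_lt.1 ht)
      simp only [Set.mem_setOf_eq] at h ⊢
      linarith)
  have h3 := key ({ω | A ω ≤ x - ε} ∩ B) ({ω | A ω + Θ ω ≤ x} ∩ B) (by
    rintro ω ⟨h, hb⟩
    by_cases ht : ε < |Θ ω|
    · exact Or.inr ht
    · refine Or.inl ⟨?_, hb⟩
      have := abs_le.1 (not_lt.1 ht)
      simp only [Set.mem_setOf_eq] at h ⊢
      linarith)
  have h4 := key {ω | A ω + Θ ω ≤ x - 2 * ε} {ω | A ω ≤ x - ε} (by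
    intro ω h
    by_cases ht : ε < |Θ ω|
    · exact Or.inr ht
    · refine Or.inl ?_
      have := abs_le.1 (not_lt.1 ht)
      simp only [Set.mem_setOf_eq] at h ⊢
      linarith)
  rw [hindep] at h1 h3
  rw [← hF] at h2 h4
  have hb0 : 0 ≤ (P B).toReal := ENNReal.toReal_nonneg
  have hb1 : (P B).toReal ≤ 1 := measureReal_le_one
  have ht0 : 0 ≤ (P {ω | ε < |Θ ω|}).toReal := ENNReal.toReal_nonneg
  have hbt := mul_le_mul_of_nonneg_right hb1 ht0
  have m1 := mul_le_mul_of_nonneg_left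
    (le_max_left (F (x + 2 * ε) - F x) (F x - F (x - 2 * ε))) hb0
  have m2 := mul_le_mul_of_nonneg_left
    (le_max_right (F (x + 2 * ε) - F x) (F x - F (x - 2 * ε))) hb0
  have h2' := mul_le_mul_of_nonneg_left h2 hb0
  have h4' := mul_le_mul_of_nonneg_left h4 hb0
  rw [hΔ, abs_le]
  constructor <;> linarith
end

section
/- For each n ∈ ℕ let (Ω_n, 𝓕_n, P_n) be a probability space carrying real random variables A_n, Θ_n and an event B_n ∈ 𝓕_n. Assume: (i) P_n({A_n ≤ s} ∩ B_n) = P_n(A_n ≤ s)·P_n(B_n) for every s ∈ ℝ and every n; (ii) for every ε > 0, P_n(|Θ_n| > ε) → 0 as n → ∞; (iii) there is a continuous function F : ℝ → ℝ (in the paper, the standard normal CDF Φ) with P_n(A_n + Θ_n ≤ z) → F(z) for every z ∈ ℝ. Then for every x ∈ ℝ, P_n({A_n + Θ_n ≤ x} ∩ B_n) − P_n(A_n + Θ_n ≤ x)·P_n(B_n) → 0 as n → ∞. -/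
open MeasureTheory Filter

/-- Abstract form of Lemma A.3 (local independence): if `A_n` is independent of the
event `B_n` for each `n`, the remainder `Θ_n` tends to `0` in probability, and
`A_n + Θ_n` converges in distribution to a continuous limit law `F`, then
`A_n + Θ_n` is asymptotically independent of `B_n`. -/
theorem stmt_9 {Ω : ℕ → Type*} [∀ n, MeasurableSpace (Ω n)]
    (P : ∀ n, Measure (Ω n)) [∀ n, IsProbabilityMeasure (P n)]
    (A Θ : ∀ n, Ω n → ℝ) (hA : ∀ n, Measurable (A n)) (hΘ : ∀ n, Measurable (Θ n))
    (B : ∀ n, Set (Ω n)) (hB : ∀ n, MeasurableSet (B n))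
    (hindep : ∀ n, ∀ s : ℝ, (P n ({ω | A n ω ≤ s} ∩ B n)).toReal
      = (P n {ω | A n ω ≤ s}).toReal * (P n (B n)).toReal)
    (hΘ0 : ∀ ε : ℝ, 0 < ε →
      Tendsto (fun n => (P n {ω | ε < |Θ n ω|}).toReal) atTop (nhds 0))
    (F : ℝ → ℝ) (hFcont : Continuous F)
    (hconv : ∀ z : ℝ,
      Tendsto (fun n => (P n {ω | A n ω + Θ n ω ≤ z}).toReal) atTop (nhds (F z))) :
    ∀ x : ℝ,
      Tendsto (fun n => (P n ({ω | A n ω + Θ n ω ≤ x} ∩ B n)).toReal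
          - (P n {ω | A n ω + Θ n ω ≤ x}).toReal * (P n (B n)).toReal)
        atTop (nhds 0) := by
  intro x
  have key : ∀ ε : ℝ, 0 < ε → ∀ n,
      |(P n ({ω | A n ω + Θ n ω ≤ x} ∩ B n)).toReal
          - (P n {ω | A n ω + Θ n ω ≤ x}).toReal * (P n (B n)).toReal|
        ≤ (P n {ω | A n ω + Θ n ω ≤ x + 2 * ε}).toReal
          - (P n {ω | A n ω + Θ n ω ≤ x - 2 * ε}).toReal
          + 2 * (P n {ω | ε < |Θ n ω|}).toReal := by
    intro ε hε n
    have hun : ∀ S U V : Set (Ω n), S ⊆ U ∪ V →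
        (P n S).toReal ≤ (P n U).toReal + (P n V).toReal := fun S U V h =>
      (measureReal_mono (μ := P n) h).trans (measureReal_union_le U V)
    have hmono : ∀ S U : Set (Ω n), S ⊆ U → (P n S).toReal ≤ (P n U).toReal :=
      fun S U h => measureReal_mono (μ := P n) h
    have hb0 : 0 ≤ (P n (B n)).toReal := ENNReal.toReal_nonneg
    have hb1 : (P n (B n)).toReal ≤ 1 := measureReal_le_one (μ := P n)
    have ht0 : 0 ≤ (P n {ω | ε < |Θ n ω|}).toReal := ENNReal.toReal_nonneg
    have split : ∀ ω, ω ∈ {ω | ε < |Θ n ω|} ∨ (-ε ≤ Θ n ω ∧ Θ n ω ≤ ε) := by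
      intro ω
      rcases lt_or_ge ε |Θ n ω| with h | h
      · exact Or.inl h
      · exact Or.inr (abs_le.mp h)
    have h1 := hun ({ω | A n ω + Θ n ω ≤ x} ∩ B n) ({ω | A n ω ≤ x + ε} ∩ B n)
      {ω | ε < |Θ n ω|} (by
        rintro ω ⟨h, hb⟩
        rcases split ω with h' | h'
        · exact Or.inr h'
        · refine Or.inl ⟨?_, hb⟩
          simp only [Set.mem_setOf_eq] at h ⊢
          linarith)
    have h2 := hun {ω | A n ω ≤ x + ε} {ω | A n ω + Θ n ω ≤ x + 2 * ε}
      {ω | ε < |Θ n ω|} (by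
        intro ω h
        rcases split ω with h' | h'
        · exact Or.inr h'
        · left
          simp only [Set.mem_setOf_eq] at h ⊢
          linarith)
    have h3 := hun ({ω | A n ω ≤ x - ε} ∩ B n) ({ω | A n ω + Θ n ω ≤ x} ∩ B n)
      {ω | ε < |Θ n ω|} (by
        rintro ω ⟨h, hb⟩
        rcases split ω with h' | h'
        · exact Or.inr h'
        · refine Or.inl ⟨?_, hb⟩
          simp only [Set.mem_setOf_eq] at h ⊢
          linarith)
    have h4 := hun {ω | A n ω + Θ n ω ≤ x - 2 * ε} {ω | A n ω ≤ x - ε}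
      {ω | ε < |Θ n ω|} (by
        intro ω h
        rcases split ω with h' | h'
        · exact Or.inr h'
        · left
          simp only [Set.mem_setOf_eq] at h ⊢
          linarith)
    have h5 := hmono {ω | A n ω + Θ n ω ≤ x} {ω | A n ω + Θ n ω ≤ x + 2 * ε} (by
      intro ω h
      simp only [Set.mem_setOf_eq] at h ⊢
      linarith)
    have h6 := hmono {ω | A n ω + Θ n ω ≤ x - 2 * ε} {ω | A n ω + Θ n ω ≤ x} (by
      intro ω h
      simp only [Set.mem_setOf_eq] at h ⊢
      linarith)
    rw [hindep] at h1 h3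
    generalize (P n (B n)).toReal = b at *
    generalize (P n {ω | ε < |Θ n ω|}).toReal = t at *
    generalize (P n {ω | A n ω + Θ n ω ≤ x + 2 * ε}).toReal = gp at *
    generalize (P n {ω | A n ω + Θ n ω ≤ x - 2 * ε}).toReal = gm at *
    generalize (P n {ω | A n ω + Θ n ω ≤ x}).toReal = g at *
    have e1 := mul_le_mul_of_nonneg_right h2 hb0
    have e2 := mul_le_mul_of_nonneg_right h4 hb0
    have e3 : (gp - g + t) * b ≤ gp - g + t := mul_le_of_le_one_right (by linarith) hb1
    have e4 : (g - gm + t) * b ≤ g - gm + t := mul_le_of_le_one_right (by linarith) hb1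
    rw [abs_le]
    constructor <;> linarith
  rw [Metric.tendsto_atTop']
  intro η hη
  obtain ⟨δ, hδ, hF⟩ := Metric.continuousAt_iff.mp (hFcont.continuousAt (x := x)) (η / 2)
    (by linarith)
  have hε : 0 < δ / 4 := by linarith
  have f1 := hF (x := x + 2 * (δ / 4)) (by
    rw [Real.dist_eq, abs_lt]; constructor <;> linarith)
  have f2 := hF (x := x - 2 * (δ / 4)) (by
    rw [Real.dist_eq, abs_lt]; constructor <;> linarith)
  rw [Real.dist_eq, abs_lt] at f1 f2
  have hlim := ((hconv (x + 2 * (δ / 4))).sub (hconv (x - 2 * (δ / 4)))).add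
    ((hΘ0 _ hε).const_mul 2)
  have hev := hlim.eventually_lt_const (u := η) (by linarith [f1.2, f2.1])
  obtain ⟨N, hN⟩ := eventually_atTop.mp hev
  refine ⟨N, fun n hn => ?_⟩
  rw [Real.dist_eq, sub_zero]
  exact (key _ hε n).trans_lt (hN n hn.le)
end
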